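/- Let D be a connected C-homogeneous digraph with more than one end, let 𝒞 be a basic cut system of D, and let S be a 𝒞-separator. Then there is no directed path in D with at least one edge whose both endvertices lie in S. -/

import Mathlib

open Set

universe u

/-- The underlying undirected graph of a digraph given by its edge relation. -/
def UG {V : Type u} (E : V → V → Prop) : SimpleGraph V := SimpleGraph.fromRel E

/-- `E` is a digraph edge relation: irreflexive and antisymmetric. -/
def IsDigraph {V : Type u} (E : V → V → Prop) : Prop :=
  (∀ x, ¬ E x x) ∧ ∀ x y, E x y → ¬ E y x

/-- A ray in a graph: a one-way infinite path. -/
def IsRay {V : Type u} (G : SimpleGraph V) (r : ℕ → V) : Prop :=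
  Function.Injective r ∧ ∀ n, G.Adj (r n) (r (n + 1))

/-- A sequence is eventually in a set. -/
def EventuallyIn {V : Type u} (r : ℕ → V) (C : Set V) : Prop :=
  ∃ N, ∀ n, N ≤ n → r n ∈ C

/-- `C` is a connected component of the subgraph of `G` induced on `W`:
a maximal connected subset of `W`. -/
def IsCompOf {V : Type u} (G : SimpleGraph V) (C W : Set V) : Prop :=
  C.Nonempty ∧ C ⊆ W ∧ (G.induce C).Connected ∧
    ∀ C', C ⊆ C' → C' ⊆ W → (G.induce C').Connected → C' = C

/-- Two rays are equivalent if for every finite vertex set `S` they lie eventually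
in the same component of the graph minus `S`. -/
def RayEquiv {V : Type u} (G : SimpleGraph V) (r r' : ℕ → V) : Prop :=
  ∀ S : Finset V, ∃ C : Set V, IsCompOf G C {v | v ∉ S} ∧
    EventuallyIn r C ∧ EventuallyIn r' C

/-- The graph has more than one end: two inequivalent rays. -/
def MoreThanOneEnd {V : Type u} (G : SimpleGraph V) : Prop :=
  ∃ r r' : ℕ → V, IsRay G r ∧ IsRay G r' ∧ ¬ RayEquiv G r r'

/-- The graph has infinitely many ends: arbitrarily large families of pairwise
inequivalent rays. -/
def InfinitelyManyEnds {V : Type u} (G : SimpleGraph V) : Prop :=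
  ∀ n : ℕ, ∃ f : Fin n → (ℕ → V), (∀ i, IsRay G (f i)) ∧
    ∀ i j, i ≠ j → ¬ RayEquiv G (f i) (f j)

/-- A separation of a graph: a pair of vertex sets covering `V` such that every
edge lies within one side. -/
def IsSeparation {V : Type u} (G : SimpleGraph V) (c : Set V × Set V) : Prop :=
  c.1 ∪ c.2 = univ ∧ ∀ x y, G.Adj x y → (x ∈ c.1 ∧ y ∈ c.1) ∨ (x ∈ c.2 ∧ y ∈ c.2)

/-- The order of a separation: the number of vertices in its separator. -/
noncomputable def sepOrder {V : Type u} (c : Set V × Set V) : ℕ := (c.1 ∩ c.2).ncard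

/-- The neighbourhood of a vertex set. -/
def Nbhd {V : Type u} (G : SimpleGraph V) (A : Set V) : Set V :=
  {v | v ∉ A ∧ ∃ u ∈ A, G.Adj u v}

/-- The separation `(A, ∼)`. -/
def tildeSep {V : Type u} (G : SimpleGraph V) (A : Set V) : Set V × Set V :=
  (A, Aᶜ ∪ Nbhd G Aᶜ)

/-- `S` separates the wings of the separation `c`: every walk from one wing to
the other meets `S`. -/
def SeparatesWings {V : Type u} (G : SimpleGraph V) (c : Set V × Set V) (S : Set V) : Prop :=
  ∀ a ∈ c.1 \ c.2, ∀ b ∈ c.2 \ c.1, ∀ w : G.Walk a b, ∃ v ∈ w.support, v ∈ S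

/-- A separation of finite order with non-empty wings is essential if its first wing is
connected and no proper subset of the separator separates the wings. -/
def IsEssential {V : Type u} (G : SimpleGraph V) (c : Set V × Set V) : Prop :=
  IsSeparation G c ∧ (c.1 ∩ c.2).Finite ∧ (c.1 \ c.2).Nonempty ∧ (c.2 \ c.1).Nonempty ∧
  (G.induce (c.1 \ c.2)).Connected ∧
  ∀ S, S ⊂ c.1 ∩ c.2 → ¬ SeparatesWings G c S

/-- `C` is a wing of some separation in `𝒞`. -/
def IsWingOf {V : Type u} (𝒞 : Set (Set V × Set V)) (C : Set V) : Prop :=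
  ∃ d ∈ 𝒞, C = d.1 \ d.2 ∨ C = d.2 \ d.1

/-- A cut system. -/
def IsCutSystem {V : Type u} (G : SimpleGraph V) (𝒞 : Set (Set V × Set V)) : Prop :=
  𝒞.Nonempty ∧ (∀ c ∈ 𝒞, IsEssential G c) ∧
  (∀ c ∈ 𝒞, ∃ d ∈ 𝒞, d.1 ⊆ c.2) ∧
  (∀ c ∈ 𝒞, ∀ C : Set V, IsCompOf G C (c.2 \ c.1) →
    (∃ d ∈ 𝒞, d.1 \ d.2 ⊆ C) → tildeSep G (C ∪ Nbhd G C) ∈ 𝒞) ∧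
  (∀ c ∈ 𝒞, ∀ c' ∈ 𝒞, ∃ C₁ C₂ : Set V,
    ((IsCompOf G C₁ ((c.1 \ c.2) ∩ (c'.1 \ c'.2)) ∧
      IsCompOf G C₂ ((c.2 \ c.1) ∩ (c'.2 \ c'.1))) ∨
     (IsCompOf G C₁ ((c.2 \ c.1) ∩ (c'.1 \ c'.2)) ∧
      IsCompOf G C₂ ((c.1 \ c.2) ∩ (c'.2 \ c'.1)))) ∧
    IsWingOf 𝒞 C₁ ∧ IsWingOf 𝒞 C₂)

/-- Pick a side of a separation. -/
def pickSide {V : Type u} (c : Set V × Set V) : Bool → Set V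
  | false => c.1
  | true => c.2

/-- Two cuts are nested (with respect to the cut system `𝒞`). -/
def NestedPair {V : Type u} (G : SimpleGraph V) (𝒞 : Set (Set V × Set V))
    (c d : Set V × Set V) : Prop :=
  ∃ i j : Bool,
    ((¬ ∃ C, IsCompOf G C ((tildeSep G (pickSide c i ∩ pickSide d j)).1 \
        (tildeSep G (pickSide c i ∩ pickSide d j)).2) ∧
        tildeSep G (C ∪ Nbhd G C) ∈ 𝒞) ∨
     (¬ ∃ C, IsCompOf G C ((tildeSep G (pickSide c i ∩ pickSide d j)).2 \
        (tildeSep G (pickSide c i ∩ pickSide d j)).1) ∧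
        tildeSep G (C ∪ Nbhd G C) ∈ 𝒞)) ∧
    (c.1 ∩ c.2) ∪ (d.1 ∩ d.2) ⊆ pickSide c (!i) ∩ pickSide d (!j)

/-- A cut system is nested if each two of its cuts are nested. -/
def IsNestedSystem {V : Type u} (G : SimpleGraph V) (𝒞 : Set (Set V × Set V)) : Prop :=
  ∀ c ∈ 𝒞, ∀ d ∈ 𝒞, NestedPair G 𝒞 c d

/-- `S` is a `𝒞`-separator. -/
def IsSeparatorOf {V : Type u} (𝒞 : Set (Set V × Set V)) (S : Set V) : Prop :=
  ∃ c ∈ 𝒞, c.1 ∩ c.2 = S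

/-- A vertex set contains an end: some ray lies in it. -/
def ContainsEnd {V : Type u} (G : SimpleGraph V) (A : Set V) : Prop :=
  ∃ r : ℕ → V, IsRay G r ∧ ∀ n, r n ∈ A

/-- A basic cut system. -/
def IsBasic {V : Type u} (G : SimpleGraph V) (𝒞 : Set (Set V × Set V)) : Prop :=
  IsCutSystem G 𝒞 ∧
  (∀ c ∈ 𝒞, ∀ d ∈ 𝒞, ¬ sepOrder c < sepOrder d) ∧
  IsNestedSystem G 𝒞 ∧
  (∀ φ : G ≃g G, ∀ c ∈ 𝒞, ((⇑φ '' c.1, ⇑φ '' c.2) : Set V × Set V) ∈ 𝒞) ∧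
  (∀ S S' : Set V, IsSeparatorOf 𝒞 S → IsSeparatorOf 𝒞 S' → ∃ φ : G ≃g G, ⇑φ '' S = S') ∧
  (∀ c ∈ 𝒞, ContainsEnd G c.1 ∧ ContainsEnd G c.2 ∧
    ¬ ∃ d : Set V × Set V, IsSeparation G d ∧ (d.1 ∩ d.2).Finite ∧
      (d.1 ∩ d.2).ncard < sepOrder c ∧ ContainsEnd G d.1 ∧ ContainsEnd G d.2)

/-- The defining property of a `𝒞`-block. -/
def BlockProp {V : Type u} (𝒞 : Set (Set V × Set V)) (X : Set V) : Prop :=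
  (∀ c ∈ 𝒞, (X ⊆ c.1 ∨ X ⊆ c.2) ∧ ¬ (X ⊆ c.1 ∧ X ⊆ c.2)) ∧
  ∃ c ∈ 𝒞, X ⊆ c.1 ∧ c.1 ∩ c.2 ⊆ X

/-- A `𝒞`-block: a maximal vertex set with the block property. -/
def IsCBlock {V : Type u} (𝒞 : Set (Set V × Set V)) (X : Set V) : Prop :=
  BlockProp 𝒞 X ∧ ∀ X', X ⊆ X' → BlockProp 𝒞 X' → X' = X

/-- A digraph is C-homogeneous: every isomorphism between finite induced
subdigraphs with connected underlying graphs extends to an automorphism. -/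
def DigraphCHom {V : Type u} (E : V → V → Prop) : Prop :=
  ∀ (X Y : Set V), X.Finite → Y.Finite → ((UG E).induce X).Connected →
  ∀ φ : X ≃ Y, (∀ a b : X, E a.1 b.1 ↔ E (φ a).1 (φ b).1) →
  ∃ ψ : Equiv.Perm V, (∀ x y, E (ψ x) (ψ y) ↔ E x y) ∧ ∀ a : X, ψ a.1 = (φ a).1

/-- A graph is C-homogeneous: every isomorphism between finite connected induced
subgraphs extends to an automorphism. -/
def GraphCHom {V : Type u} (G : SimpleGraph V) : Prop :=
  ∀ (X Y : Set V), X.Finite → Y.Finite → (G.induce X).Connected →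
  ∀ φ : X ≃ Y, (∀ a b : X, G.Adj a.1 b.1 ↔ G.Adj (φ a).1 (φ b).1) →
  ∃ ψ : G ≃g G, ∀ a : X, ψ a.1 = (φ a).1

/-- The digraph contains a triangle: three pairwise adjacent vertices. -/
def HasTriangle {V : Type u} (E : V → V → Prop) : Prop :=
  ∃ x y z : V, (UG E).Adj x y ∧ (UG E).Adj y z ∧ (UG E).Adj x z

/-- An `n`-arc: a directed path `p 0, p 1, …, p n`. -/
def IsArc {V : Type u} (E : V → V → Prop) (n : ℕ) (p : ℕ → V) : Prop :=
  (∀ i j, i ≤ n → j ≤ n → p i = p j → i = j) ∧ ∀ i < n, E (p i) (p (i + 1))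

/-- A digraph is highly-arc-transitive: for every `n`, its automorphism group acts
transitively on `n`-arcs. -/
def HighlyArcTransitive {V : Type u} (E : V → V → Prop) : Prop :=
  ∀ n : ℕ, ∀ p q : ℕ → V, IsArc E n p → IsArc E n q →
  ∃ ψ : Equiv.Perm V, (∀ x y, E (ψ x) (ψ y) ↔ E x y) ∧ ∀ i ≤ n, ψ (p i) = q i

/-- An alternating walk `w 0, …, w n` in a digraph. -/
def IsAltWalk {V : Type u} (E : V → V → Prop) (n : ℕ) (w : ℕ → V) : Prop :=
  (∀ i < n, E (w i) (w (i + 1)) ∨ E (w (i + 1)) (w i)) ∧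
  ∀ i, i + 2 ≤ n → (E (w i) (w (i + 1)) ↔ E (w (i + 2)) (w (i + 1)))

/-- The edge `e` lies on the walk `w 0, …, w n` (in either direction). -/
def EdgeOnWalk {V : Type u} (n : ℕ) (w : ℕ → V) (e : V × V) : Prop :=
  ∃ i < n, (w i = e.1 ∧ w (i + 1) = e.2) ∨ (w i = e.2 ∧ w (i + 1) = e.1)

/-- Two edges are reachable from each other: they lie on a common alternating walk. -/
def Reach {V : Type u} (E : V → V → Prop) (e f : V × V) : Prop :=
  ∃ n w, IsAltWalk E n w ∧ EdgeOnWalk n w e ∧ EdgeOnWalk n w f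

/-- The edge relation of the reachability digraph `Δ_e`. -/
def DeltaRel {V : Type u} (E : V → V → Prop) (e : V × V) : V → V → Prop :=
  fun x y => E x y ∧ Reach E e (x, y)

/-- The underlying undirected graph of the reachability digraph `Δ_e`. -/
def DeltaGraph {V : Type u} (E : V → V → Prop) (e : V × V) : SimpleGraph V :=
  UG (DeltaRel E e)

/-- Tails of edges of `𝒜(e)`. -/
def Tails {V : Type u} (E : V → V → Prop) (e : V × V) : Set V :=
  {x | ∃ y, DeltaRel E e x y}

/-- Heads of edges of `𝒜(e)`. -/
def Heads {V : Type u} (E : V → V → Prop) (e : V × V) : Set V :=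
  {y | ∃ x, DeltaRel E e x y}

/-- The set of descendants of a vertex. -/
def Descendants {V : Type u} (E : V → V → Prop) (x : V) : Set V :=
  {y | ∃ n p, IsArc E n p ∧ p 0 = x ∧ p n = y}

/-- `(X, Y)` is a bipartition of the graph `G`. -/
def IsBipartition {V : Type u} (G : SimpleGraph V) (X Y : Set V) : Prop :=
  X ∪ Y = univ ∧ Disjoint X Y ∧
  ∀ a b, G.Adj a b → (a ∈ X ∧ b ∈ Y) ∨ (a ∈ Y ∧ b ∈ X)

/-- `G` with sides `X`, `Y` is C-homogeneous bipartite: every isomorphism between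
finite connected induced subgraphs preserving the sides extends to a side-preserving
automorphism. -/
def BipCHom {V : Type u} (G : SimpleGraph V) (X Y : Set V) : Prop :=
  ∀ (A B : Set V), A.Finite → B.Finite → (G.induce A).Connected →
  ∀ φ : A ≃ B, (∀ a b : A, G.Adj a.1 b.1 ↔ G.Adj (φ a).1 (φ b).1) →
  (∀ a : A, a.1 ∈ X ↔ (φ a).1 ∈ X) → (∀ a : A, a.1 ∈ Y ↔ (φ a).1 ∈ Y) →
  ∃ ψ : G ≃g G, (∀ v, v ∈ X ↔ ψ v ∈ X) ∧ (∀ v, v ∈ Y ↔ ψ v ∈ Y) ∧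
    ∀ a : A, ψ a.1 = (φ a).1

/-- `G` with sides `X`, `Y` is homogeneous bipartite: every isomorphism between
finite induced subgraphs preserving the sides extends to a side-preserving
automorphism. -/
def BipHom {V : Type u} (G : SimpleGraph V) (X Y : Set V) : Prop :=
  ∀ (A B : Set V), A.Finite → B.Finite →
  ∀ φ : A ≃ B, (∀ a b : A, G.Adj a.1 b.1 ↔ G.Adj (φ a).1 (φ b).1) →
  (∀ a : A, a.1 ∈ X ↔ (φ a).1 ∈ X) → (∀ a : A, a.1 ∈ Y ↔ (φ a).1 ∈ Y) →
  ∃ ψ : G ≃g G, (∀ v, v ∈ X ↔ ψ v ∈ X) ∧ (∀ v, v ∈ Y ↔ ψ v ∈ Y) ∧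
    ∀ a : A, ψ a.1 = (φ a).1

/-- `G` with sides `X`, `Y` is generic bipartite. -/
def GenericBip {V : Type u} (G : SimpleGraph V) (X Y : Set V) : Prop :=
  (∀ U W : Set V, U ⊆ X → W ⊆ X → U.Finite → W.Finite → Disjoint U W →
    ∃ v ∈ Y, (∀ u ∈ U, G.Adj v u) ∧ ∀ w ∈ W, ¬ G.Adj v w) ∧
  (∀ U W : Set V, U ⊆ Y → W ⊆ Y → U.Finite → W.Finite → Disjoint U W →
    ∃ v ∈ X, (∀ u ∈ U, G.Adj v u) ∧ ∀ w ∈ W, ¬ G.Adj v w)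

section Avoiding

variable {V : Type u} {G : SimpleGraph V}

/-- `u` and `v` lie in a common component of `G` minus `S`. -/
def Avoids (G : SimpleGraph V) (S : Set V) (u v : V) : Prop :=
  u ∉ S ∧ Relation.ReflTransGen (fun a b => G.Adj a b ∧ b ∉ S) u v

/-- `u` lies outside `S`, in a component of `G` minus `S` that contains a ray. -/
def Thick (G : SimpleGraph V) (S : Set V) (u : V) : Prop :=
  ∃ r, IsRay G r ∧ ∀ n, Avoids G S u (r n)

theorem Avoids.refl {S : Set V} {u : V} (h : u ∉ S) : Avoids G S u u := ⟨h, .refl⟩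

theorem Avoids.trans {S : Set V} {u v w : V} (h : Avoids G S u v) (h' : Avoids G S v w) :
    Avoids G S u w := ⟨h.1, h.2.trans h'.2⟩

theorem Avoids.step {S : Set V} {u v w : V} (h : Avoids G S u v) (ha : G.Adj v w) (hw : w ∉ S) :
    Avoids G S u w := ⟨h.1, h.2.tail ⟨ha, hw⟩⟩

theorem Avoids.notMem_right {S : Set V} {u v : V} (h : Avoids G S u v) : v ∉ S := by
  obtain ⟨h1, h2⟩ := h
  induction h2 with
  | refl => exact h1
  | tail _ h _ => exact h.2

theorem Avoids.of_adj {S : Set V} {u v : V} (ha : G.Adj u v) (hu : u ∉ S) (hv : v ∉ S) :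
    Avoids G S u v := (Avoids.refl hu).step ha hv

theorem Avoids.symm {S : Set V} {u v : V} (h : Avoids G S u v) : Avoids G S v u := by
  obtain ⟨h1, h2⟩ := h
  induction h2 with
  | refl => exact .refl h1
  | @tail b c hb h ih => exact (Avoids.of_adj h.1.symm h.2 (Avoids.notMem_right ⟨h1, hb⟩)).trans ih

theorem Avoids.of_forall {S T : Set V} {u v : V} (h : Avoids G S u v)
    (hT : ∀ t, Avoids G S u t → t ∉ T) : Avoids G T u v := by
  obtain ⟨h1, h2⟩ := h
  induction h2 with
  | refl => exact .refl (hT _ (.refl h1))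
  | tail hb h ih => exact ih.step h.1 (hT _ (Avoids.step ⟨h1, hb⟩ h.1 h.2))

theorem Avoids.or_meets {S T : Set V} {u v : V} (h : Avoids G T u v) :
    Avoids G S u v ∨ ∃ t ∈ S, Avoids G T u t := by
  by_cases hm : ∃ t ∈ S, Avoids G T u t
  · exact .inr hm
  · push Not at hm
    exact .inl (h.of_forall fun t ht hS => hm t hS ht)

theorem Avoids.exists_finite {S : Set V} {u v : V} (h : Avoids G S u v) :
    ∃ W : Set V, W.Finite ∧ Disjoint W S ∧ ∀ T, Disjoint W T → Avoids G T u v := by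
  obtain ⟨h1, h2⟩ := h
  induction h2 with
  | refl =>
    exact ⟨{u}, finite_singleton u, by simpa using h1, fun T hT => .refl (by simpa using hT)⟩
  | @tail b c _ h ih =>
    obtain ⟨W, hf, hd, hW⟩ := ih
    refine ⟨insert c W, hf.insert c, ?_, fun T hT => ?_⟩
    · rw [disjoint_insert_left]
      exact ⟨h.2, hd⟩
    · rw [disjoint_insert_left] at hT
      exact (hW T hT.2).step h.1 hT.1

theorem Avoids.map {S : Set V} {u v : V} (ψ : Equiv.Perm V)
    (hψ : ∀ a b, G.Adj a b → G.Adj (ψ a) (ψ b)) (h : Avoids G S u v) :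
    Avoids G (ψ '' S) (ψ u) (ψ v) := by
  have hm : ∀ a, a ∉ S → ψ a ∉ ψ '' S := fun a ha h => ha ((ψ.injective.mem_set_image).1 h)
  obtain ⟨h1, h2⟩ := h
  induction h2 with
  | refl => exact .refl (hm _ h1)
  | tail _ h ih => exact ih.step (hψ _ _ h.1) (hm _ h.2)

theorem Thick.notMem {S : Set V} {u : V} (h : Thick G S u) : u ∉ S := by
  obtain ⟨r, -, h⟩ := h
  exact (h 0).1

theorem Thick.of_avoids {S : Set V} {u v : V} (h : Thick G S u) (huv : Avoids G S u v) :
    Thick G S v := by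
  obtain ⟨r, hr, h⟩ := h
  exact ⟨r, hr, fun n => huv.symm.trans (h n)⟩

theorem Thick.map {S : Set V} {u : V} (ψ : Equiv.Perm V)
    (hψ : ∀ a b, G.Adj a b → G.Adj (ψ a) (ψ b)) (h : Thick G S u) :
    Thick G (ψ '' S) (ψ u) := by
  obtain ⟨r, hr, h⟩ := h
  exact ⟨ψ ∘ r, ⟨ψ.injective.comp hr.1, fun n => hψ _ _ (hr.2 n)⟩, fun n => (h n).map ψ hψ⟩

/-- There are only finitely many minimal `u`-`v` separators of a given order. -/
theorem finite_minimal_separators (G : SimpleGraph V) (u v : V) (k : ℕ) :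
    ∀ R : Set V, {S : Set V | S.Finite ∧ R ⊆ S ∧ (S \ R).ncard = k ∧ ¬ Avoids G S u v ∧
      ∀ s ∈ S, (∃ a, Avoids G S u a ∧ G.Adj a s) ∧ ∃ b, Avoids G S v b ∧ G.Adj b s}.Finite := by
  induction k with
  | zero =>
    intro R
    refine (finite_singleton R).subset ?_
    rintro S ⟨hf, hR, hc, -⟩
    rw [ncard_eq_zero (hf.subset sdiff_subset), sdiff_eq_empty] at hc
    exact hc.antisymm hR
  | succ k ih =>
    intro R
    by_cases hR : Avoids G R u v
    · obtain ⟨W, hWf, hWR, hW⟩ := hR.exists_finite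
      refine (hWf.biUnion fun w _ => ih (insert w R)).subset ?_
      rintro S ⟨hf, hRS, hc, hS, hmin⟩
      have : ¬ Disjoint W S := fun h => hS (hW S h)
      obtain ⟨w, hwW, hwS⟩ := not_disjoint_iff.1 this
      have hwR : w ∉ R := fun h => (disjoint_left.1 hWR) hwW h
      refine mem_biUnion hwW ⟨hf, insert_subset hwS hRS, ?_, hS, hmin⟩
      have : S \ R = insert w (S \ insert w R) := by
        ext a
        by_cases a = w <;> simp_all
      rw [this, ncard_insert_of_notMem (by simp) (hf.subset sdiff_subset)] at hc
      omega
    · refine finite_empty.subset ?_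
      rintro S ⟨hf, hRS, hc, hS, hmin⟩
      obtain ⟨s, hsS, hsR⟩ : (S \ R).Nonempty := by
        rw [← ncard_pos (hf.subset sdiff_subset)]
        omega
      obtain ⟨⟨a, ha, has⟩, b, hb, hbs⟩ := hmin s hsS
      have hmono : ∀ {x y}, Avoids G S x y → Avoids G R x y := fun h =>
        h.of_forall fun t ht hR => ht.notMem_right (hRS hR)
      exact hR (((hmono ha).step has hsR).trans ((hmono hb).step hbs hsR).symm)

end Avoiding

/-- The properties of the pairs (separator, first wing) of a basic cut system that are used
below. -/
structure SeparatorSystem {V : Type u} (G : SimpleGraph V) (Q : Set V → Set V → Prop) :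
    Prop where
  finite : ∀ {S K}, Q S K → S.Finite
  ncard_eq : ∀ {S K S' K'}, Q S K → Q S' K' → S.ncard = S'.ncard
  mem_iff : ∀ {S K u v}, Q S K → u ∈ K → (v ∈ K ↔ Avoids G S u v)
  nonempty : ∀ {S K}, Q S K → K.Nonempty
  thick : ∀ {S K u}, Q S K → u ∈ K → Thick G S u
  exists_thick : ∀ {S K}, Q S K → ∃ v, Thick G S v ∧ v ∉ K
  full : ∀ {S K u s}, Q S K → Thick G S u → s ∈ S → ∃ v, Avoids G S u v ∧ G.Adj v s
  nested : ∀ {S K S' K'}, Q S K → Q S' K' → Disjoint S' K ∨ S' ⊆ K ∪ S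
  map : ∀ {S K} (ψ : Equiv.Perm V), (∀ a b, G.Adj (ψ a) (ψ b) ↔ G.Adj a b) →
    Q S K → Q (ψ '' S) (ψ '' K)

/-- The separators of the system with `u` and `v` in distinct components containing rays. -/
def sepSet {V : Type u} (G : SimpleGraph V) (Q : Set V → Set V → Prop) (u v : V) :
    Set (Set V) :=
  {S | (∃ K, Q S K) ∧ Thick G S u ∧ Thick G S v ∧ ¬ Avoids G S u v}

namespace SeparatorSystem

variable {V : Type u} {G : SimpleGraph V} {Q : Set V → Set V → Prop}

theorem finite_sepSet (hQ : SeparatorSystem G Q) (u v : V) : (sepSet G Q u v).Finite := by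
  by_cases hne : ∃ S K, Q S K
  · obtain ⟨S₀, K₀, h₀⟩ := hne
    refine (finite_minimal_separators G u v S₀.ncard ∅).subset ?_
    rintro S ⟨⟨K, h⟩, hu, hv, huv⟩
    exact ⟨hQ.finite h, empty_subset _, by simpa using hQ.ncard_eq h h₀, huv,
      fun s hs => ⟨hQ.full h hu hs, hQ.full h hv hs⟩⟩
  · refine finite_empty.subset ?_
    rintro S ⟨⟨K, h⟩, -⟩
    exact hne ⟨S, K, h⟩

theorem image_mem_sepSet (hQ : SeparatorSystem G Q) (ψ : Equiv.Perm V)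
    (hψ : ∀ a b, G.Adj (ψ a) (ψ b) ↔ G.Adj a b) {u v : V} {S : Set V}
    (h : S ∈ sepSet G Q u v) : ψ '' S ∈ sepSet G Q (ψ u) (ψ v) := by
  obtain ⟨⟨K, h⟩, hu, hv, huv⟩ := h
  refine ⟨⟨_, hQ.map ψ hψ h⟩, hu.map ψ fun a b => (hψ a b).2, hv.map ψ fun a b => (hψ a b).2,
    fun h => huv ?_⟩
  have := h.map ψ.symm fun a b h => by simpa using (hψ (ψ.symm a) (ψ.symm b)).1 (by simpa using h)
  simpa [← image_comp] using this

theorem ncard_sepSet_le (hQ : SeparatorSystem G Q) (ψ : Equiv.Perm V)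
    (hψ : ∀ a b, G.Adj (ψ a) (ψ b) ↔ G.Adj a b) (u v : V) :
    (sepSet G Q u v).ncard ≤ (sepSet G Q (ψ u) (ψ v)).ncard :=
  ncard_le_ncard_of_injOn (fun S => ψ '' S) (fun _ h => hQ.image_mem_sepSet ψ hψ h)
    (ψ.injective.image_injective.injOn) (hQ.finite_sepSet _ _)

/-- Vertices of `S` outside `S'` lie in the component of `G` minus `S'` that includes a given
component of `G` minus `S` avoiding `S'`. -/
theorem avoids_of_disjoint (hQ : SeparatorSystem G Q) {S K S' : Set V} (h : Q S K) {m x v : V}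
    (hm : Thick G S m) (hd : ∀ t, Avoids G S m t → t ∉ S') (hx : x ∈ S) (hx' : x ∉ S')
    (hv : Avoids G S m v) : Avoids G S' x v := by
  obtain ⟨w, hw, hwx⟩ := hQ.full h hm hx
  exact ((hw.of_forall hd).step hwx hx').symm.trans (hv.of_forall hd)

/-- If a component of `G` minus `S'` does not contain a given vertex of `S`, then it lies in a
component of `G` minus `S`, provided some component of `G` minus `S` avoids `S'`. -/
theorem thick_of_thick (hQ : SeparatorSystem G Q) {S K S' : Set V} (h : Q S K) {m x z : V}
    (hm : Thick G S m) (hd : ∀ t, Avoids G S m t → t ∉ S') (hx : x ∈ S) (hx' : x ∉ S')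
    (hz : Thick G S' z) (hxz : ¬ Avoids G S' x z) : Thick G S z := by
  obtain ⟨r, hr, hrz⟩ := hz
  refine ⟨r, hr, fun n => (hrz n).or_meets.resolve_right ?_⟩
  rintro ⟨t, htS, ht⟩
  have h1 := hQ.avoids_of_disjoint h hm hd hx hx' (.refl hm.notMem)
  have h2 := hQ.avoids_of_disjoint h hm hd htS ht.notMem_right (.refl hm.notMem)
  exact hxz ((h1.trans h2.symm).trans ht.symm)

theorem exists_disjoint (hQ : SeparatorSystem G Q) {S K S' K' : Set V} (h : Q S K)
    (h' : Q S' K') : ∃ m, Thick G S m ∧ ∀ t, Avoids G S m t → t ∉ S' := by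
  rcases hQ.nested h h' with hd | hd
  · obtain ⟨m, hm⟩ := hQ.nonempty h
    exact ⟨m, hQ.thick h hm, fun t ht hS => disjoint_left.1 hd hS ((hQ.mem_iff h hm).2 ht)⟩
  · obtain ⟨m, hm, hmK⟩ := hQ.exists_thick h
    refine ⟨m, hm, fun t ht hS => ?_⟩
    rcases hd hS with hK | hS
    · exact hmK ((hQ.mem_iff h hK).2 ht.symm)
    · exact ht.notMem_right hS

theorem sepSet_eq_empty (hQ : SeparatorSystem G Q) {S K : Set V} (h : Q S K) {x z : V}
    (hx : x ∈ S) (hz : ¬ Thick G S z) : sepSet G Q x z = ∅ := by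
  refine eq_empty_of_forall_notMem ?_
  rintro S' ⟨⟨K', h'⟩, hx', hz', hxz⟩
  obtain ⟨m, hm, hd⟩ := hQ.exists_disjoint h h'
  exact hz (hQ.thick_of_thick h hm hd hx hx'.notMem hz' hxz)

theorem not_avoids (hQ : SeparatorSystem G Q) {S K : Set V} (h : Q S K) {p q : V}
    (hpq : p ∈ K ↔ q ∉ K) : ¬ Avoids G S p q := fun ha => by
  by_cases hK : p ∈ K
  · exact hpq.1 hK ((hQ.mem_iff h hK).2 ha)
  · have hqK : q ∈ K := by tauto
    exact hK ((hQ.mem_iff h hqK).2 ha.symm)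

/-- A separator cannot meet components of `G` minus `S` on both sides of `S`. -/
theorem disjoint_of_opposite (hQ : SeparatorSystem G Q) {S K S' K' : Set V} (h : Q S K)
    (h' : Q S' K') {p q t : V} (hpq : p ∈ K ↔ q ∉ K) (htq : Avoids G S q t) (htS' : t ∈ S') :
    ∀ t', Avoids G S p t' → t' ∉ S' := by
  intro t' ht' hS'
  rcases hQ.nested h h' with hd | hd
  · by_cases hK : p ∈ K
    · exact disjoint_left.1 hd hS' ((hQ.mem_iff h hK).2 ht')
    · have hqK : q ∈ K := by tauto
      exact disjoint_left.1 hd htS' ((hQ.mem_iff h hqK).2 htq)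
  · by_cases hK : p ∈ K
    · rcases hd htS' with h1 | h1
      · exact hpq.1 hK ((hQ.mem_iff h h1).2 htq.symm)
      · exact htq.notMem_right h1
    · rcases hd hS' with h1 | h1
      · exact hK ((hQ.mem_iff h h1).2 ht'.symm)
      · exact ht'.notMem_right h1

theorem sepSet_ssubset (hQ : SeparatorSystem G Q) {S K : Set V} (h : Q S K) {p q x : V}
    (hp : Thick G S p) (hq : Thick G S q) (hpq : p ∈ K ↔ q ∉ K) (hx : x ∈ S) :
    sepSet G Q x q ⊂ sepSet G Q p q := by
  refine (ssubset_iff_of_subset ?_).2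
    ⟨S, ⟨⟨K, h⟩, hp, hq, hQ.not_avoids h hpq⟩, fun h => h.2.1.notMem hx⟩
  rintro S' ⟨⟨K', h'⟩, hx', hq', hxq⟩
  obtain ⟨t, htq, htS'⟩ : ∃ t, Avoids G S q t ∧ t ∈ S' := by
    by_contra hcon
    push Not at hcon
    exact hxq (hQ.avoids_of_disjoint h hq hcon hx hx'.notMem (.refl hq.notMem))
  have hxp : Avoids G S' x p := hQ.avoids_of_disjoint h hp
    (hQ.disjoint_of_opposite h h' hpq htq htS') hx hx'.notMem (.refl hp.notMem)
  exact ⟨⟨K', h'⟩, hx'.of_avoids hxp, hq', fun h => hxq (hxp.trans h)⟩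

theorem not_adj_of_opposite (hQ : SeparatorSystem G Q) {S K : Set V} (h : Q S K) {p q : V}
    (hp : p ∉ S) (hq : q ∉ S) (hpq : p ∈ K ↔ q ∉ K) : p ≠ q ∧ ¬ G.Adj p q := by
  refine ⟨?_, fun ha => hQ.not_avoids h hpq (.of_adj ha hp hq)⟩
  rintro rfl
  tauto

theorem exists_neighbors (hQ : SeparatorSystem G Q) {S K : Set V} (h : Q S K) {y : V}
    (hy : y ∈ S) : ∃ k t, Thick G S k ∧ Thick G S t ∧ k ∈ K ∧ t ∉ K ∧ G.Adj y k ∧ G.Adj y t := by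
  obtain ⟨k, hk⟩ := hQ.nonempty h
  obtain ⟨t, ht, htK⟩ := hQ.exists_thick h
  obtain ⟨k', hkk', hk'⟩ := hQ.full h (hQ.thick h hk) hy
  obtain ⟨t', htt', ht'⟩ := hQ.full h ht hy
  exact ⟨k', t', (hQ.thick h hk).of_avoids hkk', ht.of_avoids htt', (hQ.mem_iff h hk).2 hkk',
    fun hK => htK ((hQ.mem_iff h hK).2 htt'.symm), hk'.symm, ht'.symm⟩

end SeparatorSystem

section Homogeneity

variable {V : Type u} {E : V → V → Prop}

theorem UG_adj {a b : V} : (UG E).Adj a b ↔ a ≠ b ∧ (E a b ∨ E b a) :=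
  SimpleGraph.fromRel_adj E a b

theorem IsDigraph.adj (hD : IsDigraph E) {a b : V} (h : E a b) : (UG E).Adj a b :=
  UG_adj.2 ⟨fun hab => hD.1 a (by rwa [← hab] at h), .inl h⟩

theorem UG_adj_perm {ψ : Equiv.Perm V} (hψ : ∀ a b, E (ψ a) (ψ b) ↔ E a b) (a b : V) :
    (UG E).Adj (ψ a) (ψ b) ↔ (UG E).Adj a b := by
  simp [UG_adj, hψ]

/-- An isomorphism between finite induced subdigraphs with a dominating vertex extends. -/
theorem DigraphCHom.extend_star (hhom : DigraphCHom E) {n : ℕ} (f g : Fin (n + 1) → V)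
    (hf : Function.Injective f) (hg : Function.Injective g)
    (hE : ∀ i j, E (f i) (f j) ↔ E (g i) (g j)) (hstar : ∀ i, i ≠ 0 → (UG E).Adj (f 0) (f i)) :
    ∃ ψ : Equiv.Perm V, (∀ a b, E (ψ a) (ψ b) ↔ E a b) ∧ ∀ i, ψ (f i) = g i := by
  have hconn : ((UG E).induce (range f)).Connected := by
    have key : ∀ a : range f, ((UG E).induce (range f)).Reachable ⟨f 0, 0, rfl⟩ a := by
      rintro ⟨_, i, rfl⟩
      by_cases hi : i = 0
      · subst hi
        exact .refl _
      · exact SimpleGraph.Adj.reachable (hstar i hi)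
    have : Nonempty (range f) := ⟨⟨f 0, 0, rfl⟩⟩
    exact ⟨fun a b => (key a).symm.trans (key b)⟩
  obtain ⟨ψ, h1, h2⟩ := hhom (range f) (range g) (finite_range f) (finite_range g) hconn
    ((Equiv.ofInjective f hf).symm.trans (Equiv.ofInjective g hg)) (by
      rintro ⟨_, i, rfl⟩ ⟨_, j, rfl⟩
      simpa [Equiv.ofInjective_symm_apply] using hE i j)
  refine ⟨ψ, h1, fun i => ?_⟩
  simpa [Equiv.ofInjective_symm_apply] using h2 ⟨f i, i, rfl⟩

/-- `Dir E true y z` is the edge relation, `Dir E false y z` its reverse. -/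
def Dir (E : V → V → Prop) (b : Bool) (y z : V) : Prop := cond b (E y z) (E z y)

theorem Dir.not_iff {b : Bool} {y z : V} : Dir E (!b) y z ↔ Dir E b z y := by
  cases b <;> rfl

theorem Dir.perm {b : Bool} {ψ : Equiv.Perm V} (hψ : ∀ a b, E (ψ a) (ψ b) ↔ E a b) {y z : V}
    (h : Dir E b y z) : Dir E b (ψ y) (ψ z) := by
  cases b <;> exact (hψ _ _).2 h

theorem Dir.adj (hD : IsDigraph E) {b : Bool} {y z : V} (h : Dir E b y z) :
    (UG E).Adj y z := by
  cases b
  · exact (hD.adj h).symm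
  · exact hD.adj h

theorem Dir.iff_eq (hD : IsDigraph E) {b : Bool} {y z : V} (h : Dir E b y z) :
    (E y z ↔ b = true) ∧ (E z y ↔ b = false) := by
  cases b
  · exact ⟨by simpa using hD.2 _ _ h, by simpa [Dir] using h⟩
  · exact ⟨by simpa [Dir] using h, by simpa using hD.2 _ _ h⟩

theorem exists_dir {y z : V} (h : (UG E).Adj y z) (b : Bool) :
    Dir E b y z ∨ Dir E (!b) y z := by
  cases b
  · exact (UG_adj.1 h).2.symm
  · exact (UG_adj.1 h).2

theorem DigraphCHom.extend_vertex (hD : IsDigraph E) (hhom : DigraphCHom E) (y y' : V) :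
    ∃ ψ : Equiv.Perm V, (∀ a b, E (ψ a) (ψ b) ↔ E a b) ∧ ψ y = y' := by
  obtain ⟨ψ, h1, h2⟩ := hhom.extend_star (n := 0) (fun _ => y) (fun _ => y')
    (fun i j _ => by omega) (fun i j _ => by omega)
    (fun _ _ => by simp [hD.1]) (fun i hi => (hi (by omega)).elim)
  exact ⟨ψ, h1, h2 0⟩

theorem DigraphCHom.extend_edge (hD : IsDigraph E) (hhom : DigraphCHom E) {b : Bool}
    {y x y' x' : V} (h : Dir E b y x) (h' : Dir E b y' x') :
    ∃ ψ : Equiv.Perm V, (∀ a b, E (ψ a) (ψ b) ↔ E a b) ∧ ψ y = y' ∧ ψ x = x' := by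
  have e := h.iff_eq hD
  have e' := h'.iff_eq hD
  have n := (h.adj hD).ne
  have n' := (h'.adj hD).ne
  obtain ⟨ψ, h1, h2⟩ := hhom.extend_star (n := 1) ![y, x] ![y', x']
    (by intro i j; fin_cases i <;> fin_cases j <;> simp [n, n.symm])
    (by intro i j; fin_cases i <;> fin_cases j <;> simp [n', n'.symm])
    (by intro i j; fin_cases i <;> fin_cases j <;> simp [hD.1, e, e'])
    (by intro i hi; fin_cases i; exacts [(hi rfl).elim, h.adj hD])
  exact ⟨ψ, h1, h2 0, h2 1⟩

theorem DigraphCHom.extend_cherry (hD : IsDigraph E) (hhom : DigraphCHom E) {b c : Bool}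
    {y p q y' p' q' : V} (hp : Dir E b y p) (hq : Dir E c y q)
    (hpq : p ≠ q ∧ ¬ (UG E).Adj p q) (hp' : Dir E b y' p') (hq' : Dir E c y' q')
    (hpq' : p' ≠ q' ∧ ¬ (UG E).Adj p' q') :
    ∃ ψ : Equiv.Perm V, (∀ a b, E (ψ a) (ψ b) ↔ E a b) ∧ ψ y = y' ∧ ψ p = p' ∧ ψ q = q' := by
  have e1 := hp.iff_eq hD
  have e2 := hq.iff_eq hD
  have e1' := hp'.iff_eq hD
  have e2' := hq'.iff_eq hD
  have n1 := (hp.adj hD).ne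
  have n2 := (hq.adj hD).ne
  have n1' := (hp'.adj hD).ne
  have n2' := (hq'.adj hD).ne
  have a : ¬ E p q ∧ ¬ E q p := ⟨fun h => hpq.2 (hD.adj h), fun h => hpq.2 (hD.adj h).symm⟩
  have a' : ¬ E p' q' ∧ ¬ E q' p' :=
    ⟨fun h => hpq'.2 (hD.adj h), fun h => hpq'.2 (hD.adj h).symm⟩
  obtain ⟨ψ, h1, h2⟩ := hhom.extend_star (n := 2) ![y, p, q] ![y', p', q']
    (by
      intro i j
      fin_cases i <;> fin_cases j <;> simp [n1, n1.symm, n2, n2.symm, hpq.1, hpq.1.symm])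
    (by
      intro i j
      fin_cases i <;> fin_cases j <;> simp [n1', n1'.symm, n2', n2'.symm, hpq'.1, hpq'.1.symm])
    (by intro i j; fin_cases i <;> fin_cases j <;> simp [hD.1, e1, e2, e1', e2', a, a'])
    (by intro i hi; fin_cases i; exacts [(hi rfl).elim, hp.adj hD, hq.adj hD])
  exact ⟨ψ, h1, h2 0, h2 1, h2 2⟩

end Homogeneity

namespace SeparatorSystem

variable {V : Type u} {E : V → V → Prop} {Q : Set V → Set V → Prop}

theorem ncard_sepSet_le_of_cherry (hD : IsDigraph E) (hhom : DigraphCHom E)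
    (hQ : SeparatorSystem (UG E) Q) {b c : Bool} {y p q p' q' : V} (hp : Dir E b y p)
    (hq : Dir E c y q) (hpq : p ≠ q ∧ ¬ (UG E).Adj p q) (hp' : Dir E b y p') (hq' : Dir E c y q')
    (hpq' : p' ≠ q' ∧ ¬ (UG E).Adj p' q') :
    (sepSet (UG E) Q p q).ncard ≤ (sepSet (UG E) Q p' q').ncard := by
  obtain ⟨ψ, hψ, -, rfl, rfl⟩ := hhom.extend_cherry hD hp hq hpq hp' hq' hpq'
  exact hQ.ncard_sepSet_le ψ (UG_adj_perm hψ) p q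

theorem exists_same_side (hD : IsDigraph E) (hhom : DigraphCHom E)
    (hQ : SeparatorSystem (UG E) Q) {S K : Set V} (h : Q S K) {b c : Bool} {y p q x : V}
    (hyp : Dir E b y p) (hyq : Dir E c y q) (hp : Thick (UG E) S p) (hq : Thick (UG E) S q)
    (hpq : p ∈ K ↔ q ∉ K) (hx : x ∈ S) (hyx : Dir E b y x) :
    ∃ z, Dir E c y z ∧ Thick (UG E) S z ∧ (z ∈ K ↔ p ∈ K) ∧
      (sepSet (UG E) Q p q).ncard ≤ (sepSet (UG E) Q x z).ncard := by
  obtain ⟨ψ, hψ, hψy, rfl⟩ := hhom.extend_edge hD hyp hyx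
  have hyz : Dir E c y (ψ q) := by simpa [hψy] using hyq.perm hψ
  have hS : S ∈ sepSet (UG E) Q p q := ⟨⟨K, h⟩, hp, hq, hQ.not_avoids h hpq⟩
  have hne := hQ.image_mem_sepSet ψ (UG_adj_perm hψ) hS
  have hz : Thick (UG E) S (ψ q) := by
    by_contra hz
    rw [hQ.sepSet_eq_empty h hx hz] at hne
    exact hne
  have hle := hQ.ncard_sepSet_le ψ (UG_adj_perm hψ) p q
  refine ⟨ψ q, hyz, hz, ?_, hle⟩
  by_contra hside
  have hpz : p ∈ K ↔ ψ q ∉ K := by tauto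
  have h1 := ncard_lt_ncard (hQ.sepSet_ssubset h hp hz hpz hx) (hQ.finite_sepSet _ _)
  have h2 := ncard_sepSet_le_of_cherry hD hhom hQ hyp hyz
    (hQ.not_adj_of_opposite h hp.notMem hz.notMem hpz) hyp hyq
    (hQ.not_adj_of_opposite h hp.notMem hq.notMem hpq)
  omega

/-- If `y` has edges of one orientation to both sides of `S`, then none goes to `S`. -/
theorem notMem_of_opposite (hD : IsDigraph E) (hhom : DigraphCHom E)
    (hQ : SeparatorSystem (UG E) Q) {S K : Set V} (h : Q S K) {b : Bool} {y p q x : V}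
    (hyp : Dir E b y p) (hyq : Dir E b y q) (hp : Thick (UG E) S p) (hq : Thick (UG E) S q)
    (hpq : p ∈ K ↔ q ∉ K) (hyx : Dir E b y x) : x ∉ S := by
  intro hx
  obtain ⟨z, hyz, hz, hzp, hle⟩ := exists_same_side hD hhom hQ h hyp hyq hp hq hpq hx hyx
  have hqz : q ∈ K ↔ z ∉ K := by tauto
  have h1 := ncard_lt_ncard (hQ.sepSet_ssubset h hq hz hqz hx) (hQ.finite_sepSet _ _)
  have h2 := ncard_sepSet_le_of_cherry hD hhom hQ hyq hyz
    (hQ.not_adj_of_opposite h hq.notMem hz.notMem hqz) hyp hyq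
    (hQ.not_adj_of_opposite h hp.notMem hq.notMem hpq)
  omega

/-- If an edge of one orientation at `y` lies in `S`, then edges of the other orientation at `y`
go to both sides of `S`. -/
theorem exists_opposite (hD : IsDigraph E) (hhom : DigraphCHom E)
    (hQ : SeparatorSystem (UG E) Q) {S K : Set V} (h : Q S K) {b : Bool} {y x : V}
    (hy : y ∈ S) (hx : x ∈ S) (hyx : Dir E b y x) :
    ∃ p q, Dir E (!b) y p ∧ Dir E (!b) y q ∧ Thick (UG E) S p ∧ Thick (UG E) S q ∧
      p ∈ K ∧ q ∉ K := by
  obtain ⟨k, t, hk, ht, hkK, htK, hyk, hyt⟩ := hQ.exists_neighbors h hy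
  have hkt : k ∈ K ↔ t ∉ K := by tauto
  have htk : t ∈ K ↔ k ∉ K := by tauto
  rcases exists_dir hyk b with hyk | hyk <;> rcases exists_dir hyt b with hyt | hyt
  · exact (notMem_of_opposite hD hhom hQ h hyk hyt hk ht hkt hyx hx).elim
  · obtain ⟨z, hyz, hz, hzk, -⟩ := exists_same_side hD hhom hQ h hyk hyt hk ht hkt hx hyx
    exact ⟨z, t, hyz, hyt, hz, ht, hzk.2 hkK, htK⟩
  · obtain ⟨z, hyz, hz, hzt, -⟩ := exists_same_side hD hhom hQ h hyt hyk ht hk htk hx hyx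
    exact ⟨k, z, hyk, hyz, hk, hz, hkK, fun h => htK (hzt.1 h)⟩
  · exact ⟨k, t, hyk, hyt, hk, ht, hkK, htK⟩

theorem not_dir_of_mem (hD : IsDigraph E) (hhom : DigraphCHom E)
    (hQ : SeparatorSystem (UG E) Q) {S K : Set V} (h : Q S K) {b : Bool} {y x : V}
    (hy : y ∈ S) (hx : x ∈ S) : ¬ Dir E b y x := by
  intro hyx
  obtain ⟨p, q, hyp, hyq, hp, hq, hpK, hqK⟩ := exists_opposite hD hhom hQ h hy hx hyx
  obtain ⟨w, hyw, hw, hopp⟩ : ∃ w, Dir E (!b) y w ∧ Thick (UG E) S w ∧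
      ∀ z, Dir E b y z → Thick (UG E) S z → (z ∈ K ↔ w ∉ K) := by
    by_cases hz : ∃ z₀ ∈ K, Dir E b y z₀
    · obtain ⟨z₀, hz₀, hyz₀⟩ := hz
      refine ⟨q, hyq, hq, fun z hyz hz => ?_⟩
      by_contra hcon
      have hzz : z₀ ∈ K ↔ z ∉ K := by tauto
      exact notMem_of_opposite hD hhom hQ h hyz₀ hyz (hQ.thick h hz₀) hz hzz hyx hx
    · refine ⟨p, hyp, hp, fun z hyz _ => ?_⟩
      have : z ∉ K := fun hK => hz ⟨z, hK, hyz⟩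
      tauto
  obtain ⟨ψ, hψ, rfl, hψx⟩ := hhom.extend_edge hD hyx (Dir.not_iff.1 hyw)
  have h' := hQ.map ψ (UG_adj_perm hψ) h
  have hy' : y ∈ ψ '' S := ⟨x, hx, hψx⟩
  have hw' : ψ y ∈ ψ '' S := mem_image_of_mem ψ hy
  obtain ⟨p', q', hyp', hyq', hp', hq', hpK', hqK'⟩ := exists_opposite hD hhom hQ h' hy' hw' hyw
  rw [Bool.not_not] at hyp' hyq'
  have hpq' : p' ∈ ψ '' K ↔ q' ∉ ψ '' K := by tauto
  have hx' : x ∉ ψ '' S := notMem_of_opposite hD hhom hQ h' hyp' hyq' hp' hq' hpq' hyx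
  obtain ⟨z, hyz, hz, hxz⟩ : ∃ z, Dir E b y z ∧ Thick (UG E) (ψ '' S) z ∧
      ¬ Avoids (UG E) (ψ '' S) x z := by
    by_cases hxp : Avoids (UG E) (ψ '' S) x p'
    · exact ⟨q', hyq', hq', fun hxq => hQ.not_avoids h' hpq' (hxp.symm.trans hxq)⟩
    · exact ⟨p', hyp', hp', hxp⟩
  obtain ⟨m, hm, hd⟩ := hQ.exists_disjoint h h'
  have hzS : Thick (UG E) S z := hQ.thick_of_thick h hm hd hx hx' hz hxz
  exact hxz (hQ.avoids_of_disjoint h hzS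
    (hQ.disjoint_of_opposite h h' (hopp z hyz hzS) (.refl hw.notMem) hw') hx hx'
    (.refl hzS.notMem))

theorem not_adj_of_mem (hD : IsDigraph E) (hhom : DigraphCHom E)
    (hQ : SeparatorSystem (UG E) Q) {S K : Set V} (h : Q S K) {y x : V}
    (hy : y ∈ S) (hx : x ∈ S) : ¬ (UG E).Adj y x := fun ha => by
  rcases exists_dir ha true with h1 | h1 <;> exact not_dir_of_mem hD hhom hQ h hy hx h1

end SeparatorSystem

section Arcs

variable {V : Type u} {E : V → V → Prop}

theorem IsArc.shift {n m i : ℕ} {p : ℕ → V} (hp : IsArc E n p) (h : i + m ≤ n) :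
    IsArc E m (fun k => p (i + k)) := by
  refine ⟨fun a b ha hb hab => ?_, fun k hk => hp.2 (i + k) (by omega)⟩
  have := hp.1 (i + a) (i + b) (by omega) (by omega) hab
  omega

theorem IsArc.perm {n : ℕ} {p : ℕ → V} (hp : IsArc E n p) {ψ : Equiv.Perm V}
    (hψ : ∀ a b, E (ψ a) (ψ b) ↔ E a b) : IsArc E n (ψ ∘ p) :=
  ⟨fun i j hi hj h => hp.1 i j hi hj (ψ.injective h), fun i hi => (hψ _ _).2 (hp.2 i hi)⟩

/-- A chord in the direction of an arc yields a shorter arc with the same endvertices. -/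
theorem IsArc.exists_shortcut {n i j : ℕ} {p : ℕ → V} (hp : IsArc E n p) (hij : i + 1 < j)
    (hj : j ≤ n) (h : E (p i) (p j)) :
    ∃ m < n, 1 ≤ m ∧ ∃ q, IsArc E m q ∧ q 0 = p 0 ∧ q m = p n := by
  refine ⟨n - (j - i - 1), by omega, by omega,
    fun k => p (if k ≤ i then k else k + (j - i - 1)), ⟨fun a b ha hb hab => ?_, fun k hk => ?_⟩,
    by simp, ?_⟩
  · have := hp.1 _ _ (by split_ifs <;> omega) (by split_ifs <;> omega) hab
    split_ifs at this <;> omega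
  · rcases lt_trichotomy k i with hki | rfl | hki
    · simpa [hki.le, Nat.succ_le_of_lt hki] using hp.2 k (by omega)
    · have : k + 1 + (j - k - 1) = j := by omega
      simpa [this] using h
    · have h1 : ¬ k ≤ i := by omega
      have h2 : ¬ k + 1 ≤ i := by omega
      have h3 : k + 1 + (j - i - 1) = k + (j - i - 1) + 1 := by omega
      simpa [h1, h2, h3] using hp.2 (k + (j - i - 1)) (by omega)
  · have h1 : ¬ n - (j - i - 1) ≤ i := by omega
    have h2 : n - (j - i - 1) + (j - i - 1) = n := by omega
    simp only [h1, if_false, h2]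

theorem IsArc.avoids (hD : IsDigraph E) {S : Set V} {n : ℕ} {p : ℕ → V} (hp : IsArc E n p)
    (hS : ∀ k ≤ n, p k ∉ S) : ∀ k ≤ n, Avoids (UG E) S (p 0) (p k) := by
  intro k
  induction k with
  | zero => exact fun _ => .refl (hS 0 (by omega))
  | succ k ih => exact fun hk => (ih (by omega)).step (hD.adj (hp.2 k hk)) (hS _ hk)

end Arcs

namespace SeparatorSystem

variable {V : Type u} {E : V → V → Prop} {Q : Set V → Set V → Prop}

theorem exists_dir_of_edge (hD : IsDigraph E) (hhom : DigraphCHom E) {u v : V} (huv : E u v)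
    (b : Bool) (y : V) : ∃ z, Dir E b y z := by
  cases b
  · obtain ⟨ψ, hψ, rfl⟩ := hhom.extend_vertex hD v y
    exact ⟨ψ u, (hψ _ _).2 huv⟩
  · obtain ⟨ψ, hψ, rfl⟩ := hhom.extend_vertex hD u y
    exact ⟨ψ v, (hψ _ _).2 huv⟩

/-- Some directed path of length two crosses `S` at `y`. -/
theorem exists_crossing (hD : IsDigraph E) (hhom : DigraphCHom E)
    (hQ : SeparatorSystem (UG E) Q) {S K : Set V} (h : Q S K) {u v : V} (huv : E u v) {y : V}
    (hy : y ∈ S) : ∃ a b, Dir E false y a ∧ Dir E true y b ∧ a ∉ S ∧ b ∉ S ∧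
      (a ∈ K ↔ b ∉ K) := by
  obtain ⟨k, t, hk, ht, hkK, htK, hyk, hyt⟩ := hQ.exists_neighbors h hy
  have hnot : ∀ {c z}, Dir E c y z → z ∉ S := fun hz hzS =>
    not_dir_of_mem hD hhom hQ h hy hzS hz
  obtain ⟨a, ha⟩ := exists_dir_of_edge hD hhom huv false y
  obtain ⟨b, hb⟩ := exists_dir_of_edge hD hhom huv true y
  by_cases hab : a ∈ K ↔ b ∉ K
  · exact ⟨a, b, ha, hb, hnot ha, hnot hb, hab⟩
  obtain ⟨w, hyw, hw⟩ : ∃ w, (UG E).Adj y w ∧ (w ∈ K ↔ a ∉ K) := by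
    by_cases haK : a ∈ K
    · exact ⟨t, hyt, by tauto⟩
    · exact ⟨k, hyk, by tauto⟩
  rcases exists_dir hyw false with hyw | hyw
  · exact ⟨w, b, hyw, hb, hnot hyw, hnot hb, by tauto⟩
  · exact ⟨a, w, ha, hyw, hnot ha, hnot hyw, by tauto⟩

/-- In a shortest directed path between two vertices of a common separator, vertices at distance
two along the path are adjacent. -/
theorem adj_of_minimal (hD : IsDigraph E) (hhom : DigraphCHom E)
    (hQ : SeparatorSystem (UG E) Q) {n : ℕ}
    (hmin : ∀ m < n, 1 ≤ m → ∀ S K, Q S K → ∀ p, IsArc E m p → ¬ (p 0 ∈ S ∧ p m ∈ S))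
    {S K : Set V} (h : Q S K) {p : ℕ → V} (hp : IsArc E n p) (h0 : p 0 ∈ S) (hn : p n ∈ S)
    {i : ℕ} (hi : i + 2 ≤ n) : (UG E).Adj (p i) (p (i + 2)) := by
  by_contra hna
  have e1 := hp.2 i (by omega)
  have e2 := hp.2 (i + 1) (by omega)
  obtain ⟨a, b, ha, hb, haS, hbS, hab⟩ := exists_crossing hD hhom hQ h e1 h0
  have hne : p i ≠ p (i + 2) := fun heq => by
    have := hp.1 _ _ (by omega) hi heq
    omega
  obtain ⟨ψ, hψ, hψy, hψa, hψb⟩ := hhom.extend_cherry hD (b := false) (c := true) e1 e2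
    ⟨hne, hna⟩ ha hb (hQ.not_adj_of_opposite h haS hbS hab)
  have hq := hp.perm hψ
  have hi1 : ψ (p (i + 1)) ∈ S := by rwa [hψy]
  have hq1 : ∀ k ≤ i, ψ (p k) ∉ S := fun k hk hkS => by
    refine hmin (i + 1 - k) (by omega) (by omega) S K h _
      (hq.shift (i := k) (m := i + 1 - k) (by omega)) ⟨by simpa using hkS, ?_⟩
    have : k + (i + 1 - k) = i + 1 := by omega
    simpa [this] using hi1
  have hq2 : ∀ k, i + 1 < k → k ≤ n → ψ (p k) ∉ S := fun k hk hkn hkS => by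
    refine hmin (k - (i + 1)) (by omega) (by omega) S K h _
      (hq.shift (i := i + 1) (m := k - (i + 1)) (by omega)) ⟨by simpa using hi1, ?_⟩
    have : i + 1 + (k - (i + 1)) = k := by omega
    simpa [this] using hkS
  have hA : Avoids (UG E) S a (ψ (p 0)) := by
    have := (hq.shift (i := 0) (m := i) (by omega)).avoids hD (S := S)
      (fun k hk => by simpa using hq1 k hk) i le_rfl
    simpa [hψa] using this.symm
  have hB : Avoids (UG E) S b (ψ (p n)) := by
    have := (hq.shift (i := i + 2) (m := n - (i + 2)) (by omega)).avoids hD (S := S)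
      (fun k hk => hq2 _ (by omega) (by omega)) (n - (i + 2)) le_rfl
    have hin : i + 2 + (n - (i + 2)) = n := by omega
    simpa [hψb, hin] using this
  exact hQ.disjoint_of_opposite h (hQ.map ψ (UG_adj_perm hψ) h) hab hB (mem_image_of_mem ψ hn)
    _ hA (mem_image_of_mem ψ h0)

theorem not_arc (hD : IsDigraph E) (hhom : DigraphCHom E) (hQ : SeparatorSystem (UG E) Q) :
    ∀ n : ℕ, 1 ≤ n → ∀ S K, Q S K → ∀ p : ℕ → V, IsArc E n p → ¬ (p 0 ∈ S ∧ p n ∈ S) := by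
  intro n
  induction n using Nat.strong_induction_on with
  | _ n hmin =>
  rintro hn1 S K h p hp ⟨h0, hn⟩
  have hn2 : 2 ≤ n := by
    by_contra hlt
    obtain rfl : n = 1 := by omega
    exact not_adj_of_mem hD hhom hQ h h0 hn (hD.adj (hp.2 0 (by omega)))
  have hback : ∀ i j, i + 1 < j → j ≤ n → (UG E).Adj (p i) (p j) → E (p j) (p i) := by
    intro i j hij hj ha
    refine (UG_adj.1 ha).2.resolve_left fun he => ?_
    obtain ⟨m, hmn, hm, q, hq, hq0, hqm⟩ := hp.exists_shortcut hij hj he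
    exact hmin m hmn hm S K h q hq ⟨hq0 ▸ h0, hqm ▸ hn⟩
  have htwo : ∀ i, i + 2 ≤ n → (UG E).Adj (p i) (p (i + 2)) := fun i hi =>
    adj_of_minimal hD hhom hQ hmin h hp h0 hn hi
  have hstep : ∀ i, i < n → (UG E).Adj (p i) (p (i + 1)) := fun i hi => hD.adj (hp.2 i hi)
  have hex : ∃ d, ∃ i, 1 ≤ d ∧ i + d ≤ n ∧ ¬ (UG E).Adj (p i) (p (i + d)) :=
    ⟨n, 0, hn1, by omega, by simpa using not_adj_of_mem hD hhom hQ h h0 hn⟩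
  classical
  obtain ⟨i, hd1, hid, hna⟩ := Nat.find_spec hex
  have hlt : ∀ d' < Nat.find hex, ∀ i', 1 ≤ d' → i' + d' ≤ n →
      (UG E).Adj (p i') (p (i' + d')) := by
    intro d' hd' i' h1 h2
    by_contra hcon
    exact Nat.find_min hex hd' ⟨i', h1, h2, hcon⟩
  generalize Nat.find hex = d at hd1 hid hna hlt
  have hd3 : 3 ≤ d := by
    by_contra hcon
    have : d = 1 ∨ d = 2 := by omega
    rcases this with rfl | rfl
    · exact hna (hstep i (by omega))
    · exact hna (htwo i hid)
  obtain ⟨k, t, hk, ht, hkK, htK, hyk, hyt⟩ := hQ.exists_neighbors h h0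
  -- every edge lies in a directed triangle, so both sides have in-neighbours of `p 0`
  have hin : ∀ z, (UG E).Adj (p 0) z → z ∉ S →
      ∃ w, Dir E false (p 0) w ∧ w ∉ S ∧ (w ∈ K ↔ z ∈ K) := by
    intro z hyz hzS
    rcases exists_dir hyz false with hyz | hyz
    · exact ⟨z, hyz, hzS, Iff.rfl⟩
    · obtain ⟨ψ, hψ, hψ0, hψ1⟩ :=
        hhom.extend_edge hD (b := true) (hp.2 0 (by omega)) hyz
      have e1 : E z (ψ (p 2)) := by
        rw [← hψ1]
        exact (hψ _ _).2 (hp.2 1 (by omega))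
      have e2 : E (ψ (p 2)) (p 0) := by
        conv_rhs => rw [← hψ0]
        exact (hψ _ _).2 (hback 0 2 (by omega) hn2 (htwo 0 hn2))
      have hwS : ψ (p 2) ∉ S := fun hS => not_adj_of_mem hD hhom hQ h hS h0 (hD.adj e2)
      refine ⟨ψ (p 2), e2, hwS, ?_⟩
      have hav := Avoids.of_adj (hD.adj e1) hzS hwS
      exact ⟨fun hK => (hQ.mem_iff h hK).2 hav.symm, fun hK => (hQ.mem_iff h hK).2 hav⟩
  obtain ⟨a, hya, haS, haK⟩ := hin k hyk hk.notMem
  obtain ⟨b, hyb, hbS, hbK⟩ := hin t hyt ht.notMem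
  have hab : a ∈ K ↔ b ∉ K := by tauto
  have hne : p i ≠ p (i + d) := fun heq => by
    have := hp.1 _ _ (by omega) hid heq
    omega
  have e1 : E (p i) (p (i + 1)) := hp.2 i (by omega)
  have e2 : E (p (i + d)) (p (i + 1)) := by
    refine hback _ _ (by omega) hid ?_
    have := hlt (d - 1) (by omega) (i + 1) (by omega) (by omega)
    rwa [show i + 1 + (d - 1) = i + d by omega] at this
  have a1 := htwo i (by omega)
  have a2 := hstep (i + 1) (by omega)
  have a3 := hlt (d - 2) (by omega) (i + 2) (by omega) (by omega)
  rw [show i + 2 + (d - 2) = i + d by omega] at a3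
  obtain ⟨ψ, hψ, hψy, hψa, hψb⟩ := hhom.extend_cherry hD (b := false) (c := false) e1 e2
    ⟨hne, hna⟩ hya hyb (hQ.not_adj_of_opposite h haS hbS hab)
  rw [← UG_adj_perm hψ] at a1 a2 a3
  rw [hψa] at a1
  rw [hψy] at a2
  rw [hψb] at a3
  have hv : ψ (p (i + 2)) ∉ S := fun hS => not_adj_of_mem hD hhom hQ h h0 hS a2
  exact hQ.not_avoids h hab ((Avoids.of_adj a1 haS hv).step a3 hbS)

end SeparatorSystem

section Basic

variable {V : Type u} {G : SimpleGraph V}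

theorem IsRay.exists_tail {r : ℕ → V} (hr : IsRay G r) {S : Set V} (hS : S.Finite) :
    ∃ N, IsRay G (fun n => r (N + n)) ∧ ∀ n, Avoids G S (r N) (r (N + n)) := by
  obtain ⟨N, hN⟩ := (hS.preimage hr.1.injOn).bddAbove
  have hnot : ∀ n, r (N + 1 + n) ∉ S := fun n h => by
    have := hN (show N + 1 + n ∈ r ⁻¹' S from h)
    omega
  refine ⟨N + 1, ⟨fun a b h => by simpa using hr.1 h, fun n => hr.2 _⟩, fun n => ?_⟩
  induction n with
  | zero => exact .refl (hnot 0)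
  | succ n ih => exact ih.step (hr.2 _) (hnot (n + 1))

theorem IsEssential.mem_iff {c : Set V × Set V} (hc : IsEssential G c) {u v : V}
    (hu : u ∈ c.1 \ c.2) : v ∈ c.1 \ c.2 ↔ Avoids G (c.1 ∩ c.2) u v := by
  obtain ⟨⟨-, hsep⟩, -, -, -, hconn, -⟩ := hc
  constructor
  · intro hv
    obtain ⟨w⟩ := hconn.preconnected ⟨u, hu⟩ ⟨v, hv⟩
    have key : ∀ {a b : ↥(c.1 \ c.2)}, (G.induce (c.1 \ c.2)).Walk a b →
        Avoids G (c.1 ∩ c.2) a.1 b.1 := by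
      intro a b w
      have hnot : ∀ x : ↥(c.1 \ c.2), x.1 ∉ c.1 ∩ c.2 := fun x h => x.2.2 h.2
      induction w with
      | nil => exact .refl (hnot _)
      | @cons x y z h _ ih =>
        have h' : G.Adj x.1 y.1 := h
        exact (Avoids.of_adj h' (hnot x) (hnot y)).trans ih
    exact key w
  · rintro ⟨-, h⟩
    induction h with
    | refl => exact hu
    | tail _ h ih =>
      rcases hsep _ _ h.1 with h' | h'
      · exact ⟨h'.2, fun h2 => h.2 ⟨h'.2, h2⟩⟩
      · exact (ih.2 h'.1).elim

theorem ContainsEnd.exists_thick {A S : Set V} (h : ContainsEnd G A) (hS : S.Finite) :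
    ∃ u ∈ A, Thick G S u := by
  obtain ⟨r, hr, hrA⟩ := h
  obtain ⟨N, hN, hav⟩ := hr.exists_tail hS
  exact ⟨r N, hrA N, _, hN, hav⟩

theorem isSeparation_component (S : Set V) (u : V) :
    IsSeparation G ({v | Avoids G S u v} ∪ Nbhd G {v | Avoids G S u v},
      {v | Avoids G S u v}ᶜ) := by
  set C := {v | Avoids G S u v}
  refine ⟨?_, fun x y hxy => ?_⟩
  · ext v
    by_cases v ∈ C <;> simp_all
  · by_cases hx : x ∈ C <;> by_cases hy : y ∈ C
    · exact .inl ⟨.inl hx, .inl hy⟩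
    · exact .inl ⟨.inl hx, .inr ⟨hy, x, hx, hxy⟩⟩
    · exact .inl ⟨.inr ⟨hx, y, hy, hxy.symm⟩, .inl hy⟩
    · exact .inr ⟨hx, hy⟩

theorem nbhd_component_subset (S : Set V) (u : V) : Nbhd G {v | Avoids G S u v} ⊆ S := by
  rintro v ⟨hv, w, hw, hwv⟩
  by_contra hS
  exact hv (Avoids.step hw hwv hS)

theorem IsBasic.separatorSystem {𝒞 : Set (Set V × Set V)} (h : IsBasic G 𝒞) :
    SeparatorSystem G (fun S K => ∃ c ∈ 𝒞, c.1 ∩ c.2 = S ∧ c.1 \ c.2 = K) := by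
  obtain ⟨⟨-, hess, -⟩, hmin, hnest, hinv, -, hend⟩ := h
  have hthick : ∀ c ∈ 𝒞, ∀ u ∈ c.1 \ c.2, Thick G (c.1 ∩ c.2) u := by
    intro c hc u hu
    obtain ⟨v, hvA, hv⟩ := (hend c hc).1.exists_thick (hess c hc).2.1
    exact hv.of_avoids (((hess c hc).mem_iff hu).1 ⟨hvA, fun h => hv.notMem ⟨hvA, h⟩⟩).symm
  refine ⟨?_, ?_, ?_, ?_, ?_, ?_, ?_, ?_, ?_⟩
  · rintro S K ⟨c, hc, rfl, rfl⟩
    exact (hess c hc).2.1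
  · rintro S K S' K' ⟨c, hc, rfl, rfl⟩ ⟨d, hd, rfl, rfl⟩
    exact le_antisymm (not_lt.1 (hmin d hd c hc)) (not_lt.1 (hmin c hc d hd))
  · rintro S K u v ⟨c, hc, rfl, rfl⟩ hu
    exact (hess c hc).mem_iff hu
  · rintro S K ⟨c, hc, rfl, rfl⟩
    exact (hess c hc).2.2.1
  · rintro S K u ⟨c, hc, rfl, rfl⟩ hu
    exact hthick c hc u hu
  · rintro S K ⟨c, hc, rfl, rfl⟩
    obtain ⟨v, hvB, hv⟩ := (hend c hc).2.1.exists_thick (hess c hc).2.1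
    exact ⟨v, hv, fun h => h.2 hvB⟩
  · rintro S K u s ⟨c, hc, rfl, rfl⟩ hu hs
    by_contra hcon
    push Not at hcon
    set S := c.1 ∩ c.2
    set C := {v | Avoids G S u v} with hC
    have hfin : S.Finite := (hess c hc).2.1
    have hsub : Nbhd G C ⊆ S := nbhd_component_subset S u
    have hinter : (C ∪ Nbhd G C) ∩ Cᶜ = Nbhd G C := by
      ext v
      constructor
      · rintro ⟨h1 | h1, h2⟩
        exacts [(h2 h1).elim, h1]
      · exact fun h => ⟨.inr h, h.1⟩
    have hlt : (Nbhd G C).ncard < S.ncard := by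
      refine ncard_lt_ncard ((ssubset_iff_of_subset hsub).2 ⟨s, hs, ?_⟩) hfin
      rintro ⟨-, v, hv, hvs⟩
      exact hcon v hv hvs
    refine (hend c hc).2.2 ⟨(C ∪ Nbhd G C, Cᶜ), isSeparation_component S u, ?_, ?_, ?_, ?_⟩
    · rw [hinter]
      exact hfin.subset hsub
    · rw [hinter]
      exact hlt
    · obtain ⟨r, hr, hur⟩ := hu
      exact ⟨r, hr, fun n => .inl (hur n)⟩
    · by_cases huK : u ∈ c.1 \ c.2
      · obtain ⟨r, hr, hrB⟩ := (hend c hc).2.1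
        exact ⟨r, hr, fun n hn => (((hess c hc).mem_iff huK).2 hn).2 (hrB n)⟩
      · obtain ⟨v, hv⟩ := (hess c hc).2.2.1
        obtain ⟨r, hr, hvr⟩ := hthick c hc v hv
        exact ⟨r, hr, fun n hn =>
          huK (((hess c hc).mem_iff hv).2 ((hvr n).trans (Avoids.symm hn)))⟩
  · rintro S K S' K' ⟨c, hc, rfl, rfl⟩ ⟨d, hd, rfl, rfl⟩
    obtain ⟨i, j, -, hsub⟩ := hnest c hc d hd
    have hS : d.1 ∩ d.2 ⊆ pickSide c (!i) := fun v hv => (hsub (.inr hv)).1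
    cases i
    · exact .inl (disjoint_left.2 fun v hv hK => hK.2 (hS hv))
    · refine .inr fun v hv => ?_
      have h1 : v ∈ c.1 := hS hv
      by_cases h2 : v ∈ c.2
      · exact .inr ⟨h1, h2⟩
      · exact .inl ⟨h1, h2⟩
  · rintro S K ψ hψ ⟨c, hc, rfl, rfl⟩
    exact ⟨_, hinv ⟨ψ, hψ _ _⟩ c hc, (image_inter ψ.injective).symm,
      (image_sdiff ψ.injective _ _).symm⟩

end Basic

/-- No directed path (with at least one edge) of a connected C-homogeneous digraph
with more than one end has both endvertices in a separator of a basic cut system. -/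
theorem stmt_3 {V : Type u} (E : V → V → Prop) (hD : IsDigraph E)
    (hconn : (UG E).Connected) (hhom : DigraphCHom E)
    (hends : MoreThanOneEnd (UG E))
    (𝒞 : Set (Set V × Set V)) (h𝒞 : IsBasic (UG E) 𝒞)
    (S : Set V) (hS : IsSeparatorOf 𝒞 S) :
    ∀ n : ℕ, 1 ≤ n → ∀ p : ℕ → V, IsArc E n p → ¬ (p 0 ∈ S ∧ p n ∈ S) := by
  intro n hn p hp
  obtain ⟨c, hc, rfl⟩ := hS
  exact SeparatorSystem.not_arc hD hhom h𝒞.separatorSystem n hn _ _ ⟨c, hc, rfl, rfl⟩ p hp
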